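/- Let β = 1 and let f ∈ L¹(−1,1). Define Q₁f(x) := (1/π)·∫_{−1}^{1} (t/(1+tx))·f(t) dt for x ∈ (−1,1). Then for every n ≥ 1 all the series in the iterate T₁^n(Q₁f) converge absolutely at every point, and |T₁^n(Q₁f)(x)| ≤ (2/π)·(1−x²)^{−1}·‖f‖_{L¹(−1,1)} for all x ∈ (−1,1); moreover T₁^n(Q₁f)(x) → 0 as n → +∞, uniformly on every compact subset of (−1,1). -/

import Mathlib

open MeasureTheory Set Filter

/-- The subtransfer operator `T_β f(x) = ∑_{j∈ℤ, j≠0} (β/(x+2j)²) f(-β/(x+2j))`. -/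
noncomputable def Tsub (β : ℝ) (f : ℝ → ℝ) (x : ℝ) : ℝ :=
  ∑' j : {j : ℤ // j ≠ 0},
    (β / (x + 2 * ((j : ℤ) : ℝ)) ^ 2) * f (-β / (x + 2 * ((j : ℤ) : ℝ)))

/-- `Q₁ f(x) = (1/π) ∫_{-1}^{1} (t/(1+tx)) f(t) dt`. -/
noncomputable def Qone (f : ℝ → ℝ) (x : ℝ) : ℝ :=
  (1 / Real.pi) * ∫ t in Ioo (-1 : ℝ) 1, (t / (1 + t * x)) * f t


open scoped ENNReal Topology

/-! ### Even and odd parts of the negative binomial series -/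

theorem hasSum_even_choose_mul_pow (N : ℕ) {y : ℝ} (hy : |y| < 1) :
    HasSum (fun m : ℕ => 2 * ((2 * m + N).choose N : ℝ) * y ^ (2 * m))
      (1 / (1 - y) ^ (N + 1) + 1 / (1 + y) ^ (N + 1)) := by
  have h1 := hasSum_choose_mul_geometric_of_norm_lt_one N (r := y) (by simpa using hy)
  have h2 := hasSum_choose_mul_geometric_of_norm_lt_one N (r := -y) (by simpa using hy)
  have h := h1.add h2
  rw [sub_neg_eq_add] at h
  have hinj : Function.Injective (fun m : ℕ => 2 * m) := fun a b hab => by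
    simpa using hab
  rw [← hinj.hasSum_iff] at h
  · refine Eq.subst (motive := fun g => HasSum g _) (funext fun m => ?_) h
    simp only [Function.comp, Even.neg_pow (even_two_mul m)]
    ring
  · intro n hn
    have hodd : Odd n := by
      rw [← Nat.not_even_iff_odd]
      rintro ⟨m, rfl⟩
      exact hn ⟨m, by simp [two_mul]⟩
    rw [hodd.neg_pow]
    ring

theorem hasSum_odd_choose_mul_pow (N : ℕ) {y : ℝ} (hy : |y| < 1) :
    HasSum (fun k : ℕ => 2 * ((2 * k + 1 + N).choose N : ℝ) * y ^ (2 * k + 1))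
      (1 / (1 - y) ^ (N + 1) - 1 / (1 + y) ^ (N + 1)) := by
  have h1 := hasSum_choose_mul_geometric_of_norm_lt_one N (r := y) (by simpa using hy)
  have h2 := hasSum_choose_mul_geometric_of_norm_lt_one N (r := -y) (by simpa using hy)
  have h := h1.sub h2
  rw [sub_neg_eq_add] at h
  have hinj : Function.Injective (fun k : ℕ => 2 * k + 1) := fun a b hab => by
    simpa using hab
  rw [← hinj.hasSum_iff] at h
  · refine Eq.subst (motive := fun g => HasSum g _) (funext fun k => ?_) h
    simp only [Function.comp, Odd.neg_pow (odd_two_mul_add_one k)]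
    ring
  · intro n hn
    have heven : Even n := by
      rw [← Nat.not_odd_iff_even]
      rintro ⟨k, rfl⟩
      exact hn ⟨k, rfl⟩
    rw [heven.neg_pow]
    ring

/-! ### A reversible Markov matrix on `ℕ` -/

/-- The squared reciprocal of the `j`-th positive even integer. -/
noncomputable def evenInvSq (j : ℕ) : ℝ≥0∞ := ENNReal.ofReal (1 / (2 * ((j : ℝ) + 1)) ^ 2)

/-- The power sums `∑ (2j)^{-2n}` over the positive even integers. -/
noncomputable def evenZeta (n : ℕ) : ℝ≥0∞ := ∑' j : ℕ, evenInvSq j ^ n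

/-- The matrix of `T₁` acting on the coefficients of even power series. -/
noncomputable def evenMatrix (m k : ℕ) : ℝ≥0∞ :=
  2 * ((2 * m + (2 * k + 1)).choose (2 * m) : ℝ≥0∞) * evenZeta (m + k + 1)

/-- The action of `evenMatrix` on sequences. -/
noncomputable def evenStep (a : ℕ → ℝ≥0∞) (m : ℕ) : ℝ≥0∞ := ∑' k, evenMatrix m k * a k

theorem tsum_evenMatrix (m : ℕ) : ∑' k, evenMatrix m k = 1 := by
  set u : ℕ → ℝ := fun j => 1 / (2 * (j : ℝ) + 1) ^ (2 * m + 1) with hu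
  have hu_anti : ∀ j, u (j + 1) ≤ u j := fun j => by
    simp only [hu]
    gcongr
    simp
  have hu_lim : Tendsto u atTop (𝓝 0) := by
    have h1 : Tendsto (fun j : ℕ => (2 * (j : ℝ) + 1)) atTop atTop :=
      tendsto_atTop_add_const_right _ _
        (tendsto_natCast_atTop_atTop.const_mul_atTop (by norm_num))
    have h2 := (tendsto_pow_atTop (α := ℝ) (n := 2 * m + 1) (by omega)).comp h1
    simpa [hu, Function.comp_def, Pi.inv_def] using h2.inv_tendsto_atTop
  have htel : HasSum (fun j => u j - u (j + 1)) 1 := by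
    rw [hasSum_iff_tendsto_nat_of_nonneg (fun j => sub_nonneg.2 (hu_anti j))]
    simp_rw [Finset.sum_range_sub' u]
    simpa [hu] using hu_lim.const_sub (u 0)
  have hrow : ∀ j : ℕ, ∑' k : ℕ, 2 * ((2 * m + (2 * k + 1)).choose (2 * m) : ℝ≥0∞) *
      evenInvSq j ^ (m + k + 1) = ENNReal.ofReal (u j - u (j + 1)) := by
    intro j
    obtain ⟨y, hy⟩ : ∃ y : ℝ, y = 1 / (2 * ((j : ℝ) + 1)) := ⟨_, rfl⟩
    have hz : (0 : ℝ) < 2 * ((j : ℝ) + 1) := by positivity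
    have hy0 : 0 < y := by rw [hy]; positivity
    have hy1 : y < 1 := by
      rw [hy, div_lt_one hz]
      linarith [(Nat.cast_nonneg j : (0 : ℝ) ≤ j)]
    have h := (hasSum_odd_choose_mul_pow (2 * m) (y := y) (by rwa [abs_of_pos hy0])).mul_left
      (y ^ (2 * m + 1))
    have hval : y ^ (2 * m + 1) *
        (1 / (1 - y) ^ (2 * m + 1) - 1 / (1 + y) ^ (2 * m + 1)) = u j - u (j + 1) := by
      have e1 : y / (1 - y) = 1 / (2 * (j : ℝ) + 1) := by
        have : (1 - y) ≠ 0 := by linarith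
        rw [div_eq_div_iff this (by positivity), hy]
        field_simp
        ring
      have e2 : y / (1 + y) = 1 / (2 * ((j + 1 : ℕ) : ℝ) + 1) := by
        have : (1 + y) ≠ 0 := by linarith
        rw [div_eq_div_iff this (by positivity), hy]
        push_cast
        field_simp
      simp only [hu]
      rw [← one_div_pow (2 * (j : ℝ) + 1), ← one_div_pow (2 * ((j + 1 : ℕ) : ℝ) + 1), ← e1, ← e2, div_pow, div_pow, mul_sub, mul_one_div,
        mul_one_div]
    rw [hval] at h
    rw [← h.tsum_eq, ENNReal.ofReal_tsum_of_nonneg (fun k => by positivity) h.summable]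
    refine tsum_congr fun k => ?_
    have : y ^ (2 * m + 1) * (2 * ((2 * k + 1 + 2 * m).choose (2 * m) : ℝ) * y ^ (2 * k + 1)) =
        2 * ((2 * m + (2 * k + 1)).choose (2 * m) : ℝ) * (y ^ 2) ^ (m + k + 1) := by
      rw [add_comm (2 * k + 1) (2 * m)]
      ring
    rw [this, ENNReal.ofReal_mul (by positivity), ENNReal.ofReal_mul (by norm_num),
      ENNReal.ofReal_natCast, ENNReal.ofReal_pow (by positivity), evenInvSq, hy, one_div_pow]
    simp
  simp only [evenMatrix, evenZeta, ← ENNReal.tsum_mul_left]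
  rw [ENNReal.tsum_comm]
  simp_rw [hrow]
  rw [← ENNReal.ofReal_tsum_of_nonneg (fun j => sub_nonneg.2 (hu_anti j)) htel.summable,
    htel.tsum_eq, ENNReal.ofReal_one]

theorem evenMatrix_reversible (m k : ℕ) :
    (2 * k + 1) * evenMatrix m k = (2 * m + 1) * evenMatrix k m := by
  have h : (2 * k + 1) * (2 * m + (2 * k + 1)).choose (2 * m) =
      (2 * m + 1) * (2 * k + (2 * m + 1)).choose (2 * k) := by
    have h1 := Nat.add_one_mul_choose_eq (2 * m + 2 * k) (2 * k)
    have h2 := Nat.add_one_mul_choose_eq (2 * m + 2 * k) (2 * m)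
    have h3 : (2 * m + 2 * k).choose (2 * k) = (2 * m + 2 * k).choose (2 * m) :=
      (Nat.choose_symm_add).symm
    have h4 : (2 * m + (2 * k + 1)).choose (2 * m) = (2 * m + (2 * k + 1)).choose (2 * k + 1) :=
      Nat.choose_symm_add
    have h5 : (2 * k + (2 * m + 1)).choose (2 * k) = (2 * k + (2 * m + 1)).choose (2 * m + 1) :=
      Nat.choose_symm_add
    rw [h4, h5]
    have e1 : 2 * m + (2 * k + 1) = (2 * m + 2 * k).succ := by omega
    have e2 : 2 * k + (2 * m + 1) = (2 * m + 2 * k).succ := by omega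
    rw [e1, e2]
    rw [h3] at h1
    linarith
  have h' : ((2 * k + 1 : ℝ≥0∞)) * ((2 * m + (2 * k + 1)).choose (2 * m) : ℝ≥0∞) =
      (2 * m + 1) * ((2 * k + (2 * m + 1)).choose (2 * k) : ℝ≥0∞) := by
    exact_mod_cast h
  unfold evenMatrix
  rw [add_comm k m]
  calc _ = 2 * ((2 * k + 1) * ((2 * m + (2 * k + 1)).choose (2 * m) : ℝ≥0∞)) *
        evenZeta (m + k + 1) := by ring
    _ = _ := by rw [h']; ring

theorem ENNReal.rearrange_mul_add_mul {u v a b : ℝ≥0∞} (huv : v ≤ u) (hab : b ≤ a) :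
    u * b + v * a ≤ u * a + v * b := by
  obtain ⟨d, rfl⟩ := exists_add_of_le huv
  calc (v + d) * b + v * a = v * b + v * a + d * b := by ring
    _ ≤ v * b + v * a + d * a := by gcongr
    _ = _ := by ring

theorem evenZeta_mul_le {s t : ℕ} (hst : s ≤ t) :
    evenZeta t * evenZeta (s + 1) ≤ evenZeta s * evenZeta (t + 1) := by
  have hprod : ∀ p q : ℕ, evenZeta p * evenZeta q =
      ∑' i, ∑' j, evenInvSq i ^ p * evenInvSq j ^ q := fun p q => by
    simp only [evenZeta, ENNReal.tsum_mul_left, ENNReal.tsum_mul_right]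
  have hsymm : ∀ p q : ℕ, 2 * (evenZeta p * evenZeta q) = ∑' i, ∑' j,
      (evenInvSq i ^ p * evenInvSq j ^ q + evenInvSq j ^ p * evenInvSq i ^ q) := fun p q => by
    simp only [ENNReal.tsum_add]
    rw [← hprod, two_mul, ENNReal.tsum_comm (f := fun i j => evenInvSq j ^ p * evenInvSq i ^ q),
      ← hprod]
  rw [← ENNReal.mul_le_mul_iff_right two_ne_zero ENNReal.ofNat_ne_top, hsymm, hsymm]
  refine ENNReal.tsum_le_tsum fun i => ENNReal.tsum_le_tsum fun j => ?_
  obtain ⟨d, rfl⟩ := Nat.exists_eq_add_of_le hst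
  generalize evenInvSq i = x
  generalize evenInvSq j = y
  have key : x ^ d * y + y ^ d * x ≤ x ^ d * x + y ^ d * y := by
    rcases le_total x y with h | h
    · have := ENNReal.rearrange_mul_add_mul (pow_le_pow_left' h d) h
      calc _ = y ^ d * x + x ^ d * y := by ring
        _ ≤ _ := this
        _ = _ := by ring
    · exact ENNReal.rearrange_mul_add_mul (pow_le_pow_left' h d) h
  calc _ = (x * y) ^ s * (x ^ d * y + y ^ d * x) := by ring
    _ ≤ (x * y) ^ s * (x ^ d * x + y ^ d * y) := by gcongr
    _ = _ := by ring

theorem evenMatrix_mul_le (m : ℕ) {k l : ℕ} (hkl : k ≤ l) :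
    evenMatrix m l * evenMatrix (m + 1) k ≤ evenMatrix m k * evenMatrix (m + 1) l := by
  have hrec : ∀ i : ℕ, (2 * (m + 1) + (2 * i + 1)).choose (2 * (m + 1)) *
      ((2 * m + 2) * (2 * m + 1)) =
      (2 * m + (2 * i + 1)).choose (2 * m) * ((2 * m + 2 * i + 3) * (2 * m + 2 * i + 2)) := by
    intro i
    have h1 := Nat.add_one_mul_choose_eq (2 * m + (2 * i + 1)) (2 * m)
    have h2 := Nat.add_one_mul_choose_eq (2 * m + (2 * i + 1) + 1) (2 * m + 1)
    have e1 : 2 * (m + 1) + (2 * i + 1) = 2 * m + (2 * i + 1) + 1 + 1 := by ring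
    have e2 : 2 * (m + 1) = 2 * m + 1 + 1 := by ring
    rw [e1, e2]
    calc _ = ((2 * m + (2 * i + 1) + 1 + 1).choose (2 * m + 1 + 1) * (2 * m + 1 + 1)) *
          (2 * m + 1) := by ring
      _ = (2 * m + (2 * i + 1) + 1 + 1) *
          ((2 * m + (2 * i + 1) + 1).choose (2 * m + 1) * (2 * m + 1)) := by rw [← h2]; ring
      _ = _ := by rw [← h1]; ring
  have hchoose : (2 * m + (2 * l + 1)).choose (2 * m) *
      (2 * (m + 1) + (2 * k + 1)).choose (2 * (m + 1)) ≤
      (2 * m + (2 * k + 1)).choose (2 * m) *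
      (2 * (m + 1) + (2 * l + 1)).choose (2 * (m + 1)) := by
    have hpos : 0 < (2 * m + 2) * (2 * m + 1) := by positivity
    refine Nat.le_of_mul_le_mul_right ?_ hpos
    rw [mul_assoc, hrec, mul_assoc, hrec, mul_left_comm]
    gcongr
  have hchoose' : ((2 * m + (2 * l + 1)).choose (2 * m) : ℝ≥0∞) *
      ((2 * (m + 1) + (2 * k + 1)).choose (2 * (m + 1)) : ℝ≥0∞) ≤
      ((2 * m + (2 * k + 1)).choose (2 * m) : ℝ≥0∞) *
      ((2 * (m + 1) + (2 * l + 1)).choose (2 * (m + 1)) : ℝ≥0∞) := by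
    exact_mod_cast hchoose
  have hzeta := evenZeta_mul_le (show m + k + 1 ≤ m + l + 1 by omega)
  have ek : m + 1 + k + 1 = m + k + 1 + 1 := by omega
  have el : m + 1 + l + 1 = m + l + 1 + 1 := by omega
  unfold evenMatrix
  rw [ek, el]
  calc _ = 4 * (((2 * m + (2 * l + 1)).choose (2 * m) : ℝ≥0∞) *
      ((2 * (m + 1) + (2 * k + 1)).choose (2 * (m + 1)) : ℝ≥0∞)) *
      (evenZeta (m + l + 1) * evenZeta (m + k + 1 + 1)) := by ring
    _ ≤ 4 * (((2 * m + (2 * k + 1)).choose (2 * m) : ℝ≥0∞) *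
      ((2 * (m + 1) + (2 * l + 1)).choose (2 * (m + 1)) : ℝ≥0∞)) *
      (evenZeta (m + k + 1) * evenZeta (m + l + 1 + 1)) := by gcongr
    _ = _ := by ring

theorem antitone_evenStep {a : ℕ → ℝ≥0∞} (ha : Antitone a) : Antitone (evenStep a) := by
  refine antitone_nat_of_succ_le fun m => ?_
  have hprod : ∀ p q : ℕ → ℝ≥0∞, ∑' k, q k = 1 → ∑' k, p k * a k =
      ∑' k, ∑' l, p k * q l * a k := fun p q hq => by
    refine tsum_congr fun k => ?_
    rw [ENNReal.tsum_mul_right, ENNReal.tsum_mul_left, hq, mul_one]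
  have hm := tsum_evenMatrix m
  have hm' := tsum_evenMatrix (m + 1)
  have h1 : 2 * evenStep a (m + 1) = ∑' k, ∑' l,
      (evenMatrix m l * evenMatrix (m + 1) k * a k +
        evenMatrix m k * evenMatrix (m + 1) l * a l) := by
    simp only [ENNReal.tsum_add]
    rw [ENNReal.tsum_comm (f := fun k l => evenMatrix m k * evenMatrix (m + 1) l * a l)]
    simp only [mul_comm (evenMatrix m _) (evenMatrix (m + 1) _)]
    rw [← hprod _ _ hm, two_mul, evenStep]
  have h2 : 2 * evenStep a m = ∑' k, ∑' l,
      (evenMatrix m l * evenMatrix (m + 1) k * a l +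
        evenMatrix m k * evenMatrix (m + 1) l * a k) := by
    simp only [ENNReal.tsum_add]
    rw [ENNReal.tsum_comm (f := fun k l => evenMatrix m l * evenMatrix (m + 1) k * a l),
      ← hprod _ _ hm', two_mul, evenStep]
  rw [← ENNReal.mul_le_mul_iff_right two_ne_zero ENNReal.ofNat_ne_top, h1, h2]
  refine ENNReal.tsum_le_tsum fun k => ENNReal.tsum_le_tsum fun l => ?_
  rcases le_total k l with h | h
  · rw [add_comm, add_comm (evenMatrix m l * _ * _)]
    exact ENNReal.rearrange_mul_add_mul (evenMatrix_mul_le m h) (ha h)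
  · exact ENNReal.rearrange_mul_add_mul (evenMatrix_mul_le m h) (ha h)

theorem evenStep_const (c : ℝ≥0∞) : evenStep (fun _ => c) = fun _ => c := by
  funext m
  rw [evenStep, ENNReal.tsum_mul_right, tsum_evenMatrix, one_mul]

theorem evenStep_linear (c d : ℝ≥0∞) (a b : ℕ → ℝ≥0∞) :
    evenStep (fun k => c * a k + d * b k) =
      fun m => c * evenStep a m + d * evenStep b m := by
  funext m
  simp only [evenStep, ← ENNReal.tsum_mul_left, ← ENNReal.tsum_add]
  exact tsum_congr fun k => by ring

theorem tsum_evenStep_div (a : ℕ → ℝ≥0∞) :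
    ∑' m : ℕ, evenStep a m * (2 * m + 1 : ℝ≥0∞)⁻¹ = ∑' k : ℕ, a k * (2 * k + 1 : ℝ≥0∞)⁻¹ := by
  have h0 : ∀ n : ℕ, (2 * n + 1 : ℝ≥0∞) ≠ 0 := fun n => by simp
  have ht : ∀ n : ℕ, (2 * n + 1 : ℝ≥0∞) ≠ ∞ := fun n => by finiteness
  have hrev : ∀ m k : ℕ, evenMatrix m k * (2 * m + 1 : ℝ≥0∞)⁻¹ =
      evenMatrix k m * (2 * k + 1 : ℝ≥0∞)⁻¹ := fun m k => by
    rw [← div_eq_mul_inv, ← div_eq_mul_inv, ENNReal.div_eq_div_iff (h0 k) (ht k) (h0 m) (ht m)]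
    exact evenMatrix_reversible m k
  simp only [evenStep, ← ENNReal.tsum_mul_right]
  rw [ENNReal.tsum_comm]
  refine tsum_congr fun k => ?_
  calc _ = ∑' m, evenMatrix k m * ((2 * k + 1 : ℝ≥0∞)⁻¹ * a k) :=
        tsum_congr fun m => by rw [mul_right_comm, hrev]; ring
    _ = _ := by rw [ENNReal.tsum_mul_right, tsum_evenMatrix, one_mul, mul_comm]

/-- The coefficients of the iterates of `T₁` on the constant function `1`. -/
noncomputable def oneCoeff (n : ℕ) : ℕ → ℝ≥0∞ := evenStep^[n] (Pi.single 0 1)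

theorem oneCoeff_succ (n : ℕ) : oneCoeff (n + 1) = evenStep (oneCoeff n) :=
  Function.iterate_succ_apply' _ _ _

theorem antitone_oneCoeff (n : ℕ) : Antitone (oneCoeff n) := by
  induction n with
  | zero =>
    refine antitone_nat_of_succ_le fun m => ?_
    simp [oneCoeff]
  | succ n ih =>
    rw [oneCoeff_succ]
    exact antitone_evenStep ih

theorem tsum_oneCoeff_div (n : ℕ) :
    ∑' k : ℕ, oneCoeff n k * (2 * k + 1 : ℝ≥0∞)⁻¹ = 1 := by
  induction n with
  | zero =>
    rw [tsum_eq_single 0 (fun k hk => by simp [oneCoeff, hk])]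
    simp [oneCoeff]
  | succ n ih => rw [oneCoeff_succ, tsum_evenStep_div, ih]

theorem oneCoeff_succ_zero_add_le (n k : ℕ) :
    oneCoeff (n + 1) 0 + evenMatrix 0 k * oneCoeff n 0 ≤
      oneCoeff n 0 + evenMatrix 0 k * oneCoeff n k := by
  have hsplit : ∀ b : ℕ → ℝ≥0∞, ∑' i, evenMatrix 0 i * b i = evenMatrix 0 k * b k +
      ∑' i, if i = k then 0 else evenMatrix 0 i * b i :=
    fun b => by convert ENNReal.tsum_eq_add_tsum_ite k
  have hconst : oneCoeff n 0 = ∑' i, evenMatrix 0 i * oneCoeff n 0 := by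
    rw [ENNReal.tsum_mul_right, tsum_evenMatrix, one_mul]
  have hle : (∑' i, if i = k then 0 else evenMatrix 0 i * oneCoeff n i) ≤
      ∑' i, if i = k then 0 else evenMatrix 0 i * oneCoeff n 0 := by
    refine ENNReal.tsum_le_tsum fun i => ?_
    split_ifs
    · rfl
    · gcongr
      exact antitone_oneCoeff n (Nat.zero_le i)
  calc _ = evenMatrix 0 k * oneCoeff n k +
        (∑' i, if i = k then 0 else evenMatrix 0 i * oneCoeff n i) +
        evenMatrix 0 k * oneCoeff n 0 := by
        rw [oneCoeff_succ, evenStep, hsplit]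
    _ ≤ evenMatrix 0 k * oneCoeff n k +
        (∑' i, if i = k then 0 else evenMatrix 0 i * oneCoeff n 0) +
        evenMatrix 0 k * oneCoeff n 0 := by gcongr
    _ = (∑' i, evenMatrix 0 i * oneCoeff n 0) + evenMatrix 0 k * oneCoeff n k := by
        rw [hsplit (fun _ => oneCoeff n 0)]
        ring
    _ = _ := by rw [← hconst]

theorem evenMatrix_ne_top (m k : ℕ) : evenMatrix m k ≠ ∞ :=
  ne_top_of_le_ne_top ENNReal.one_ne_top ((ENNReal.le_tsum k).trans_eq (tsum_evenMatrix m))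

theorem evenMatrix_zero_ne_zero (k : ℕ) : evenMatrix 0 k ≠ 0 := by
  have hz : evenZeta (0 + k + 1) ≠ 0 := by
    intro h
    have h0 := ENNReal.tsum_eq_zero.1 h 0
    simp [evenInvSq] at h0
  simp only [evenMatrix]
  refine mul_ne_zero (by simp) hz

theorem oneCoeff_zero_succ_le (n : ℕ) : oneCoeff (n + 1) 0 ≤ oneCoeff n 0 := by
  calc oneCoeff (n + 1) 0 = ∑' i, evenMatrix 0 i * oneCoeff n i := by
        rw [oneCoeff_succ, evenStep]
    _ ≤ ∑' i, evenMatrix 0 i * oneCoeff n 0 :=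
        ENNReal.tsum_le_tsum fun i => by
          gcongr
          exact antitone_oneCoeff n (Nat.zero_le i)
    _ = _ := by rw [ENNReal.tsum_mul_right, tsum_evenMatrix, one_mul]

theorem oneCoeff_le_one (n m : ℕ) : oneCoeff n m ≤ 1 := by
  refine (antitone_oneCoeff n (Nat.zero_le m)).trans ?_
  induction n with
  | zero => simp [oneCoeff]
  | succ n ih => exact (oneCoeff_zero_succ_le n).trans ih

theorem oneCoeff_ne_top (n m : ℕ) : oneCoeff n m ≠ ∞ :=
  ne_top_of_le_ne_top ENNReal.one_ne_top (oneCoeff_le_one n m)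

theorem tendsto_oneCoeff_zero : Tendsto (fun n => oneCoeff n 0) atTop (𝓝 0) := by
  set b : ℕ → ℝ := fun n => (oneCoeff n 0).toReal with hb
  have hb_anti : Antitone b := antitone_nat_of_succ_le fun n =>
    ENNReal.toReal_mono (oneCoeff_ne_top n 0) (oneCoeff_zero_succ_le n)
  have hb_bdd : BddBelow (range b) := ⟨0, by rintro _ ⟨n, rfl⟩; exact ENNReal.toReal_nonneg⟩
  obtain ⟨M, hM⟩ : ∃ M, Tendsto b atTop (𝓝 M) := ⟨_, tendsto_atTop_ciInf hb_anti hb_bdd⟩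
  have hM0 : 0 ≤ M := ge_of_tendsto' hM fun n => ENNReal.toReal_nonneg
  set β : ℕ → ℝ := fun k => (evenMatrix 0 k).toReal with hβ
  have hβpos : ∀ k, 0 < β k := fun k =>
    ENNReal.toReal_pos (evenMatrix_zero_ne_zero k) (evenMatrix_ne_top 0 k)
  have hlow : ∀ n k, b n - (b n - b (n + 1)) / β k ≤ (oneCoeff n k).toReal := by
    intro n k
    have h := ENNReal.toReal_mono (by
      have := oneCoeff_ne_top n 0
      have := oneCoeff_ne_top n k
      have := evenMatrix_ne_top 0 k
      finiteness) (oneCoeff_succ_zero_add_le n k)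
    rw [ENNReal.toReal_add (oneCoeff_ne_top _ _)
        (ENNReal.mul_ne_top (evenMatrix_ne_top _ _) (oneCoeff_ne_top _ _)),
      ENNReal.toReal_add (oneCoeff_ne_top _ _)
        (ENNReal.mul_ne_top (evenMatrix_ne_top _ _) (oneCoeff_ne_top _ _)),
      ENNReal.toReal_mul, ENNReal.toReal_mul] at h
    change b (n + 1) + β k * b n ≤ b n + β k * (oneCoeff n k).toReal at h
    have : b n - (oneCoeff n k).toReal ≤ (b n - b (n + 1)) / β k := by
      rw [le_div_iff₀ (hβpos k)]
      linarith
    linarith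
  have hsum : ∀ N n : ℕ,
      ∑ k ∈ Finset.range N, (b n - (b n - b (n + 1)) / β k) / (2 * k + 1) ≤ 1 := by
    intro N n
    have h := (ENNReal.sum_le_tsum (Finset.range N)).trans_eq (tsum_oneCoeff_div n)
    have h' := ENNReal.toReal_mono ENNReal.one_ne_top h
    rw [ENNReal.toReal_sum (fun k _ => ENNReal.mul_ne_top (oneCoeff_ne_top _ _) (by simp)),
      ENNReal.toReal_one] at h'
    refine le_trans (Finset.sum_le_sum fun k _ => ?_) h'
    have e : ((2 * (k : ℝ≥0∞) + 1)).toReal = 2 * (k : ℝ) + 1 := by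
      rw [ENNReal.toReal_add (by finiteness) (by simp)]
      simp
    rw [ENNReal.toReal_mul, ENNReal.toReal_inv, e, ← div_eq_mul_inv]
    gcongr
    exact hlow n k
  have hlim : ∀ N : ℕ, M * ∑ k ∈ Finset.range N, (1 : ℝ) / (2 * k + 1) ≤ 1 := by
    intro N
    have ht : Tendsto (fun n => ∑ k ∈ Finset.range N,
        (b n - (b n - b (n + 1)) / β k) / (2 * (k : ℝ) + 1)) atTop
        (𝓝 (∑ k ∈ Finset.range N, (M - (M - M) / β k) / (2 * (k : ℝ) + 1))) :=
      tendsto_finsetSum _ fun k _ =>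
        (hM.sub ((hM.sub (hM.comp (tendsto_add_atTop_nat 1))).div_const _)).div_const _
    have h := le_of_tendsto' ht (hsum N)
    simpa [Finset.mul_sum, div_eq_mul_inv] using h
  have hMzero : M = 0 := by
    by_contra hne
    have hMpos : 0 < M := lt_of_le_of_ne hM0 (Ne.symm hne)
    obtain ⟨N, hN⟩ := (Real.tendsto_sum_range_one_div_nat_succ_atTop.eventually_gt_atTop
      (2 / M)).exists
    have hcomp : (1 / 2) * ∑ k ∈ Finset.range N, (1 : ℝ) / (k + 1) ≤
        ∑ k ∈ Finset.range N, (1 : ℝ) / (2 * k + 1) := by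
      rw [Finset.mul_sum]
      refine Finset.sum_le_sum fun k _ => ?_
      rw [div_mul_div_comm, one_mul]
      gcongr
      linarith
    have h1 : M * ((1 / 2) * (2 / M)) < 1 :=
      lt_of_lt_of_le (by gcongr) ((mul_le_mul_of_nonneg_left hcomp hM0).trans (hlim N))
    have h2 : M * ((1 / 2) * (2 / M)) = 1 := by field_simp
    linarith
  rw [hMzero] at hM
  have h := ENNReal.tendsto_ofReal hM
  simpa [hb, ENNReal.ofReal_toReal (oneCoeff_ne_top _ _)] using h

/-! ### The subtransfer operator on even power series -/

/-- The operator `T₁` on `[0, ∞]`-valued functions. -/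
noncomputable def TsubENN (g : ℝ → ℝ≥0∞) (x : ℝ) : ℝ≥0∞ :=
  ∑' j : {j : ℤ // j ≠ 0}, ENNReal.ofReal (1 / (x + 2 * ((j : ℤ) : ℝ)) ^ 2) *
    g (-1 / (x + 2 * ((j : ℤ) : ℝ)))

/-- The even power series `∑ aₖ x^{2k}`. -/
noncomputable def evenSeries (a : ℕ → ℝ≥0∞) (x : ℝ) : ℝ≥0∞ :=
  ∑' k, a k * ENNReal.ofReal (x ^ 2) ^ k

theorem tsum_int_ne_zero (F : ℤ → ℝ≥0∞) :
    ∑' j : {j : ℤ // j ≠ 0}, F j = ∑' n : ℕ, (F (n + 1) + F (-(n + 1))) := by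
  have h := tsum_subtype {j : ℤ | j ≠ 0} F
  rw [show (∑' j : {j : ℤ // j ≠ 0}, F j) = ∑' j : {j : ℤ | j ≠ 0}, F j from rfl, h,
    tsum_of_nat_of_neg_add_one ENNReal.summable ENNReal.summable,
    tsum_eq_zero_add' ENNReal.summable, ENNReal.tsum_add]
  have h1 : ∀ n : ℕ, ((n : ℤ) + 1) ≠ 0 := fun n => by omega
  have h2 : ∀ n : ℕ, -((n : ℤ) + 1) ≠ 0 := fun n => by omega
  simp [Set.indicator, h1, h2, -neg_add_rev]

theorem two_le_abs_two_mul_intCast {j : ℤ} (hj : j ≠ 0) : 2 ≤ |2 * (j : ℝ)| := by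
  have h : (1 : ℝ) ≤ |(j : ℝ)| := by exact_mod_cast Int.one_le_abs hj
  rw [abs_mul, abs_two]
  linarith

theorem neg_one_div_mem_Ioo {x : ℝ} (hx : x ∈ Ioo (-1 : ℝ) 1) {j : ℤ} (hj : j ≠ 0) :
    -1 / (x + 2 * (j : ℝ)) ∈ Ioo (-1 : ℝ) 1 := by
  have hx' : |x| < 1 := abs_lt.2 hx
  have h : 1 < |x + 2 * (j : ℝ)| := by
    have h1 := two_le_abs_two_mul_intCast hj
    have h2 := abs_sub_abs_le_abs_sub (2 * (j : ℝ)) (-x)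
    rw [abs_neg, sub_neg_eq_add, add_comm] at h2
    rw [add_comm] at h2
    rw [add_comm x]
    linarith
  refine abs_lt.1 ?_
  rw [abs_div, abs_neg, abs_one, div_lt_one (by linarith)]
  exact h

theorem TsubENN_mono {g₁ g₂ : ℝ → ℝ≥0∞} (h : ∀ x ∈ Ioo (-1 : ℝ) 1, g₁ x ≤ g₂ x)
    {x : ℝ} (hx : x ∈ Ioo (-1 : ℝ) 1) : TsubENN g₁ x ≤ TsubENN g₂ x :=
  ENNReal.tsum_le_tsum fun j => by
    gcongr
    exact h _ (neg_one_div_mem_Ioo hx j.2)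

theorem tsum_evenMatrix_term (j k : ℕ) {x : ℝ} (hx : x ∈ Ioo (-1 : ℝ) 1) :
    ∑' m : ℕ, 2 * ((2 * m + (2 * k + 1)).choose (2 * m) : ℝ≥0∞) * evenInvSq j ^ (m + k + 1) *
      ENNReal.ofReal (x ^ 2) ^ m =
    ENNReal.ofReal ((1 / (x + 2 * ((j : ℝ) + 1)) ^ 2) ^ (k + 1)) +
      ENNReal.ofReal ((1 / (x + 2 * (-((j : ℝ) + 1))) ^ 2) ^ (k + 1)) := by
  obtain ⟨z, hz⟩ : ∃ z : ℝ, z = 2 * ((j : ℝ) + 1) := ⟨_, rfl⟩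
  have hz2 : 2 ≤ z := by
    rw [hz]
    linarith [(Nat.cast_nonneg j : (0 : ℝ) ≤ j)]
  have hz0 : 0 < z := by linarith
  have hy : |x / z| < 1 := by
    rw [abs_div, abs_of_pos hz0, div_lt_one hz0]
    linarith [abs_lt.2 hx]
  have h := (hasSum_even_choose_mul_pow (2 * k + 1) hy).mul_left ((1 / z) ^ (2 * k + 2))
  have hval : (1 / z) ^ (2 * k + 2) *
      (1 / (1 - x / z) ^ (2 * k + 1 + 1) + 1 / (1 + x / z) ^ (2 * k + 1 + 1)) =
      (1 / (x + z) ^ 2) ^ (k + 1) + (1 / (x - z) ^ 2) ^ (k + 1) := by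
    have e1 : (1 / z) * (1 / (1 - x / z)) = 1 / (z - x) := by
      rw [one_div_mul_one_div, mul_sub, mul_div_cancel₀ _ hz0.ne', mul_one]
    have e2 : (1 / z) * (1 / (1 + x / z)) = 1 / (x + z) := by
      rw [one_div_mul_one_div, mul_add, mul_div_cancel₀ _ hz0.ne', mul_one, add_comm]
    rw [mul_add, ← one_div_pow, ← one_div_pow (1 + x / z), show 2 * k + 1 + 1 = 2 * k + 2 by ring,
      ← mul_pow, ← mul_pow, e1, e2, add_comm, show 2 * k + 2 = 2 * (k + 1) by ring, pow_mul,
      pow_mul, one_div_pow, one_div_pow (z - x), ← neg_sub x z, neg_sq]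
  rw [hval] at h
  rw [mul_neg, ← sub_eq_add_neg, ← hz, ← ENNReal.ofReal_add (by positivity) (by positivity),
    ← h.tsum_eq, ENNReal.ofReal_tsum_of_nonneg ?_ h.summable]
  · refine tsum_congr fun m => ?_
    have : (1 / z) ^ (2 * k + 2) *
        (2 * ((2 * m + (2 * k + 1)).choose (2 * k + 1) : ℝ) * (x / z) ^ (2 * m)) =
        2 * ((2 * m + (2 * k + 1)).choose (2 * m) : ℝ) * (1 / z ^ 2) ^ (m + k + 1) *
          (x ^ 2) ^ m := by
      rw [Nat.choose_symm_add (a := 2 * m) (b := 2 * k + 1)]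
      field_simp
      ring
    rw [this, ENNReal.ofReal_mul (by positivity), ENNReal.ofReal_mul (by positivity),
      ENNReal.ofReal_mul (by norm_num), ENNReal.ofReal_natCast,
      ENNReal.ofReal_pow (sq_nonneg x), ENNReal.ofReal_pow (one_div_nonneg.2 (sq_nonneg z)),
      evenInvSq, hz]
    simp
  · intro m
    rw [pow_mul (x / z)]
    positivity

theorem TsubENN_evenSeries (a : ℕ → ℝ≥0∞) {x : ℝ} (hx : x ∈ Ioo (-1 : ℝ) 1) :
    TsubENN (evenSeries a) x = evenSeries (evenStep a) x := by
  have hterm : ∀ z : ℝ, ENNReal.ofReal (1 / z ^ 2) * evenSeries a (-1 / z) =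
      ∑' k, a k * ENNReal.ofReal ((1 / z ^ 2) ^ (k + 1)) := by
    intro z
    rw [evenSeries, ← ENNReal.tsum_mul_left]
    refine tsum_congr fun k => ?_
    rw [ENNReal.ofReal_pow (one_div_nonneg.2 (sq_nonneg z)), div_pow, neg_one_sq]
    ring
  rw [TsubENN, tsum_int_ne_zero (fun j => ENNReal.ofReal (1 / (x + 2 * (j : ℝ)) ^ 2) *
    evenSeries a (-1 / (x + 2 * (j : ℝ))))]
  push_cast
  simp only [hterm, ← ENNReal.tsum_add, ← mul_add]
  simp only [← tsum_evenMatrix_term _ _ hx, ← ENNReal.tsum_mul_left]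
  have hexp : evenSeries (evenStep a) x = ∑' m, ∑' k, ∑' j, a k *
      (2 * ((2 * m + (2 * k + 1)).choose (2 * m) : ℝ≥0∞) * evenInvSq j ^ (m + k + 1) *
      ENNReal.ofReal (x ^ 2) ^ m) := by
    simp only [evenSeries, evenStep, evenMatrix, evenZeta, ← ENNReal.tsum_mul_left,
      ← ENNReal.tsum_mul_right]
    refine tsum_congr fun m => tsum_congr fun k => tsum_congr fun j => by ring
  rw [hexp, ENNReal.tsum_comm]
  calc _ = ∑' k, ∑' m, ∑' j, a k *
      (2 * ((2 * m + (2 * k + 1)).choose (2 * m) : ℝ≥0∞) * evenInvSq j ^ (m + k + 1) *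
      ENNReal.ofReal (x ^ 2) ^ m) := tsum_congr fun k => ENNReal.tsum_comm
    _ = _ := ENNReal.tsum_comm

theorem evenSeries_const (c : ℝ≥0∞) {x : ℝ} (hx : x ∈ Ioo (-1 : ℝ) 1) :
    evenSeries (fun _ => c) x = c * ENNReal.ofReal (1 - x ^ 2)⁻¹ := by
  have hx2 : x ^ 2 < 1 := by
    rw [sq_lt_one_iff_abs_lt_one]
    exact abs_lt.2 hx
  rw [evenSeries, ENNReal.tsum_mul_left, ENNReal.tsum_geometric,
    ENNReal.ofReal_inv_of_pos (by linarith), ENNReal.ofReal_sub _ (sq_nonneg x), ENNReal.ofReal_one]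

theorem evenSeries_le {a : ℕ → ℝ≥0∞} (ha : Antitone a) {x : ℝ} (hx : x ∈ Ioo (-1 : ℝ) 1) :
    evenSeries a x ≤ a 0 * ENNReal.ofReal (1 - x ^ 2)⁻¹ := by
  rw [← evenSeries_const _ hx]
  exact ENNReal.tsum_le_tsum fun k => by
    gcongr
    exact ha (Nat.zero_le k)

theorem enorm_Tsub_term (φ : ℝ → ℝ) (z : ℝ) :
    ‖(1 / z ^ 2) * φ (-1 / z)‖ₑ = ENNReal.ofReal (1 / z ^ 2) * ‖φ (-1 / z)‖ₑ := by
  rw [enorm_mul, Real.enorm_of_nonneg (by positivity)]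

theorem enorm_Tsub_le (φ : ℝ → ℝ) (x : ℝ) : ‖Tsub 1 φ x‖ₑ ≤ TsubENN (fun y => ‖φ y‖ₑ) x := by
  refine enorm_tsum_le_tsum_enorm.trans_eq ?_
  simp only [enorm_Tsub_term]
  rfl

theorem enorm_iterate_Tsub_le {φ : ℝ → ℝ} {a : ℕ → ℝ≥0∞}
    (h : ∀ x ∈ Ioo (-1 : ℝ) 1, ‖φ x‖ₑ ≤ evenSeries a x) (n : ℕ) :
    ∀ x ∈ Ioo (-1 : ℝ) 1, ‖(Tsub 1)^[n] φ x‖ₑ ≤ evenSeries (evenStep^[n] a) x := by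
  induction n with
  | zero => exact h
  | succ n ih =>
    intro x hx
    rw [Function.iterate_succ_apply', Function.iterate_succ_apply', ← TsubENN_evenSeries _ hx]
    exact (enorm_Tsub_le _ x).trans (TsubENN_mono ih hx)

theorem iterate_evenStep_const (c : ℝ≥0∞) (n : ℕ) : evenStep^[n] (fun _ => c) = fun _ => c :=
  Function.iterate_fixed (evenStep_const c) n

theorem iterate_evenStep_combination (c d : ℝ≥0∞) (n : ℕ) :
    evenStep^[n] (fun k => c * oneCoeff 0 k + d) = fun k => c * oneCoeff n k + d := by
  induction n with
  | zero => rfl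
  | succ n ih =>
    rw [Function.iterate_succ_apply', ih, oneCoeff_succ]
    simpa [evenStep_const] using evenStep_linear c d (oneCoeff n) (fun _ => 1)

theorem summable_abs_Tsub_term {φ : ℝ → ℝ} {c : ℝ≥0∞} (hc : c ≠ ∞)
    (h : ∀ x ∈ Ioo (-1 : ℝ) 1, ‖φ x‖ₑ ≤ evenSeries (fun _ => c) x)
    {x : ℝ} (hx : x ∈ Ioo (-1 : ℝ) 1) :
    Summable (fun j : {j : ℤ // j ≠ 0} =>
      |(1 / (x + 2 * ((j : ℤ) : ℝ)) ^ 2) * φ (-1 / (x + 2 * ((j : ℤ) : ℝ)))|) := by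
  simp only [← Real.norm_eq_abs]
  rw [← tsum_enorm_ne_top_iff_summable_norm]
  simp only [enorm_Tsub_term]
  refine ne_top_of_le_ne_top ?_ (TsubENN_mono h hx)
  rw [TsubENN_evenSeries _ hx, evenStep_const, evenSeries_const _ hx]
  exact ENNReal.mul_ne_top hc ENNReal.ofReal_ne_top

/-! ### Bounds for `Q₁` -/

theorem abs_kernel_le {t x : ℝ} (ht : t ∈ Ioo (-1 : ℝ) 1) (hx : x ∈ Ioo (-1 : ℝ) 1) :
    |t / (1 + t * x)| ≤ 2 * (1 - x ^ 2)⁻¹ := by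
  have ht' : |t| < 1 := abs_lt.2 ht
  have hx' : |x| < 1 := abs_lt.2 hx
  have h1 : 1 - |x| ≤ 1 + t * x := by
    have h2 : -(|t| * |x|) ≤ t * x := by
      rw [← abs_mul]
      exact neg_abs_le _
    nlinarith [abs_nonneg x, abs_nonneg t]
  have hpos : 0 < 1 + t * x := by linarith
  have hsq : x ^ 2 = |x| ^ 2 := (sq_abs x).symm
  have hden : 0 < 1 - x ^ 2 := by
    rw [hsq]
    nlinarith [abs_nonneg x]
  rw [abs_div, abs_of_pos hpos, ← div_eq_mul_inv, div_le_div_iff₀ hpos hden, hsq]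
  have h3 : 1 - |x| ^ 2 = (1 - |x|) * (1 + |x|) := by ring
  calc |t| * (1 - |x| ^ 2) ≤ 1 * (1 - |x| ^ 2) := by
        gcongr
        rw [← hsq]
        exact hden.le
    _ = (1 + |x|) * (1 - |x|) := by ring
    _ ≤ 2 * (1 + t * x) := by
        gcongr
        linarith

theorem abs_kernel_le_of_abs_le {t x r : ℝ} (hr : r < 1) (ht : |t| ≤ r)
    (hx : x ∈ Ioo (-1 : ℝ) 1) : |t / (1 + t * x)| ≤ (1 - r)⁻¹ := by
  have hx' : |x| < 1 := abs_lt.2 hx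
  have h1 : 1 - r ≤ 1 + t * x := by
    have h2 : -(|t| * |x|) ≤ t * x := by
      rw [← abs_mul]
      exact neg_abs_le _
    nlinarith [abs_nonneg x, abs_nonneg t]
  have hr' : 0 < 1 - r := by linarith
  rw [abs_div, abs_of_pos (by linarith : 0 < 1 + t * x), ← one_div]
  gcongr
  linarith

theorem enorm_Qone_le (f : ℝ → ℝ) (x : ℝ) :
    ‖Qone f x‖ₑ ≤ ENNReal.ofReal (1 / Real.pi) *
      ∫⁻ t in Ioo (-1 : ℝ) 1, ‖t / (1 + t * x)‖ₑ * ‖f t‖ₑ := by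
  rw [Qone, enorm_mul, Real.enorm_of_nonneg (by positivity)]
  gcongr
  refine (enorm_integral_le_lintegral_enorm _).trans_eq ?_
  simp only [enorm_mul]

theorem enorm_Qone_le_evenSeries_const (f : ℝ → ℝ) {x : ℝ} (hx : x ∈ Ioo (-1 : ℝ) 1) :
    ‖Qone f x‖ₑ ≤ evenSeries
      (fun _ => ENNReal.ofReal (2 / Real.pi) * ∫⁻ t in Ioo (-1 : ℝ) 1, ‖f t‖ₑ) x := by
  rw [evenSeries_const _ hx]
  calc ‖Qone f x‖ₑ ≤ ENNReal.ofReal (1 / Real.pi) *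
      ∫⁻ t in Ioo (-1 : ℝ) 1, ‖t / (1 + t * x)‖ₑ * ‖f t‖ₑ := enorm_Qone_le f x
    _ ≤ ENNReal.ofReal (1 / Real.pi) *
      ∫⁻ t in Ioo (-1 : ℝ) 1, ENNReal.ofReal (2 * (1 - x ^ 2)⁻¹) * ‖f t‖ₑ := by
        refine mul_le_mul_right ?_ _
        refine setLIntegral_mono' measurableSet_Ioo fun t ht => ?_
        gcongr
        rw [Real.enorm_eq_ofReal_abs]
        exact ENNReal.ofReal_le_ofReal (abs_kernel_le ht hx)
    _ = _ := by
        rw [lintegral_const_mul' _ _ ENNReal.ofReal_ne_top, ENNReal.ofReal_mul (by norm_num),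
          div_eq_mul_one_div 2, ENNReal.ofReal_mul (by norm_num)]
        ring

theorem evenSeries_oneCoeff_zero (x : ℝ) : evenSeries (oneCoeff 0) x = 1 := by
  rw [evenSeries, tsum_eq_single 0 (fun k hk => by simp [oneCoeff, hk])]
  simp [oneCoeff]

theorem enorm_Qone_le_evenSeries {f : ℝ → ℝ} (hf : IntegrableOn f (Ioo (-1) 1)) {r : ℝ}
    (hr : r < 1) {x : ℝ} (hx : x ∈ Ioo (-1 : ℝ) 1) :
    ‖Qone f x‖ₑ ≤ evenSeries (fun k => (ENNReal.ofReal (1 / Real.pi) *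
        (ENNReal.ofReal (1 - r)⁻¹ * ∫⁻ t in Ioo (-1 : ℝ) 1, ‖f t‖ₑ)) * oneCoeff 0 k +
      ENNReal.ofReal (2 / Real.pi) *
        ∫⁻ t in {t | r < |t|}, ‖f t‖ₑ ∂(volume.restrict (Ioo (-1) 1))) x := by
  have hs : MeasurableSet {t : ℝ | r < |t|} := measurableSet_lt measurable_const measurable_norm
  have hsplit : ∀ (c d : ℝ≥0∞), evenSeries (fun k => c * oneCoeff 0 k + d) x =
      c + d * ENNReal.ofReal (1 - x ^ 2)⁻¹ := fun c d => by
    have h1 : c = c * evenSeries (oneCoeff 0) x := by rw [evenSeries_oneCoeff_zero, mul_one]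
    rw [← evenSeries_const d hx]
    conv_rhs => rw [h1]
    simp only [evenSeries, ← ENNReal.tsum_mul_left, ← ENNReal.tsum_add]
    exact tsum_congr fun k => by ring
  rw [hsplit]
  calc ‖Qone f x‖ₑ ≤ ENNReal.ofReal (1 / Real.pi) *
      ∫⁻ t in Ioo (-1 : ℝ) 1, ‖t / (1 + t * x)‖ₑ * ‖f t‖ₑ := enorm_Qone_le f x
    _ ≤ ENNReal.ofReal (1 / Real.pi) *
      ∫⁻ t in Ioo (-1 : ℝ) 1, (ENNReal.ofReal (1 - r)⁻¹ * ‖f t‖ₑ +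
        ENNReal.ofReal (2 * (1 - x ^ 2)⁻¹) * {t : ℝ | r < |t|}.indicator (‖f ·‖ₑ) t) := by
        refine mul_le_mul_right ?_ _
        refine setLIntegral_mono' measurableSet_Ioo fun t ht => ?_
        rw [Real.enorm_eq_ofReal_abs (t / _)]
        by_cases h : r < |t|
        · rw [Set.indicator_of_mem (show t ∈ {t : ℝ | r < |t|} from h)]
          refine le_add_left ?_
          gcongr
          exact abs_kernel_le ht hx
        · refine le_add_right ?_
          gcongr
          exact abs_kernel_le_of_abs_le hr (not_lt.1 h) hx
    _ = _ := by
        rw [lintegral_add_left' (hf.aestronglyMeasurable.enorm.const_mul _),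
          lintegral_const_mul' _ _ ENNReal.ofReal_ne_top,
          lintegral_const_mul' _ _ ENNReal.ofReal_ne_top, lintegral_indicator hs,
          ENNReal.ofReal_mul (by norm_num), div_eq_mul_one_div 2,
          ENNReal.ofReal_mul (by norm_num)]
        ring

theorem exists_setLIntegral_enorm_near_endpoints_lt {f : ℝ → ℝ}
    (hf : IntegrableOn f (Ioo (-1) 1)) {η : ℝ≥0∞} (hη : η ≠ 0) :
    ∃ r < (1 : ℝ), ∫⁻ t in {t | r < |t|}, ‖f t‖ₑ ∂(volume.restrict (Ioo (-1) 1)) < η := by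
  set s : ℕ → Set ℝ := fun n => {t | 1 - 1 / ((n : ℝ) + 1) < |t|} with hs
  have hs_meas : ∀ n, MeasurableSet (s n) := fun n =>
    measurableSet_lt measurable_const measurable_norm
  have hs_anti : Antitone s := fun m n hmn t ht => by
    refine lt_of_le_of_lt ?_ (show 1 - 1 / ((n : ℝ) + 1) < |t| from ht)
    gcongr
  have hμ : volume.restrict (Ioo (-1 : ℝ) 1) (⋂ n, s n) = 0 := by
    rw [Measure.restrict_apply (MeasurableSet.iInter hs_meas)]
    convert measure_empty (μ := volume)
    refine eq_empty_of_forall_notMem fun t ⟨h1, h2⟩ => ?_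
    have hlt : |t| < 1 := abs_lt.2 h2
    obtain ⟨n, hn⟩ := exists_nat_one_div_lt (sub_pos.2 hlt)
    have := mem_iInter.1 h1 n
    exact absurd (show 1 - 1 / ((n : ℝ) + 1) < |t| from this) (by linarith)
  have hlim : Tendsto (fun n => volume.restrict (Ioo (-1 : ℝ) 1) (s n)) atTop (𝓝 0) := by
    rw [← hμ]
    exact tendsto_measure_iInter_atTop (fun n => (hs_meas n).nullMeasurableSet) hs_anti
      ⟨0, measure_ne_top _ _⟩
  have h := tendsto_setLIntegral_zero (μ := volume.restrict (Ioo (-1 : ℝ) 1))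
    (f := fun t => ‖f t‖ₑ) hf.hasFiniteIntegral.ne hlim
  obtain ⟨n, hn⟩ := (h.eventually_lt_const (pos_iff_ne_zero.2 hη)).exists
  exact ⟨1 - 1 / ((n : ℝ) + 1), by linarith [Nat.one_div_pos_of_nat (α := ℝ) (n := n)], hn⟩

theorem eventually_enorm_iterate_Tsub_Qone_le {f : ℝ → ℝ} (hf : IntegrableOn f (Ioo (-1) 1))
    {η : ℝ≥0∞} (hη : η ≠ 0) :
    ∀ᶠ n in atTop, ∀ x ∈ Ioo (-1 : ℝ) 1,
      ‖(Tsub 1)^[n] (Qone f) x‖ₑ ≤ η * ENNReal.ofReal (1 - x ^ 2)⁻¹ := by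
  have hη2 : η / 2 ≠ 0 := by simpa using hη
  obtain ⟨r, hr, hrη⟩ := exists_setLIntegral_enorm_near_endpoints_lt hf hη2
  set c : ℝ≥0∞ := ENNReal.ofReal (1 / Real.pi) *
    (ENNReal.ofReal (1 - r)⁻¹ * ∫⁻ t in Ioo (-1 : ℝ) 1, ‖f t‖ₑ) with hc
  set d : ℝ≥0∞ := ENNReal.ofReal (2 / Real.pi) *
    ∫⁻ t in {t | r < |t|}, ‖f t‖ₑ ∂(volume.restrict (Ioo (-1) 1)) with hd
  have hctop : c ≠ ∞ :=
    ENNReal.mul_ne_top ENNReal.ofReal_ne_top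
      (ENNReal.mul_ne_top ENNReal.ofReal_ne_top hf.hasFiniteIntegral.ne)
  have hdη : d ≤ η / 2 := by
    calc d ≤ 1 * (η / 2) := by
          rw [hd]
          gcongr
          rw [ENNReal.ofReal_le_one, div_le_one Real.pi_pos]
          exact Real.two_le_pi
      _ = _ := one_mul _
  have hlim : Tendsto (fun n => c * oneCoeff n 0) atTop (𝓝 0) := by
    simpa using ENNReal.Tendsto.const_mul tendsto_oneCoeff_zero (Or.inr hctop)
  filter_upwards [hlim.eventually_lt_const (pos_iff_ne_zero.2 hη2)] with n hn x hx
  have h := enorm_iterate_Tsub_le (fun x hx => enorm_Qone_le_evenSeries hf hr hx) n x hx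
  rw [iterate_evenStep_combination] at h
  refine h.trans ((evenSeries_le (fun i j hij => ?_) hx).trans ?_)
  · gcongr
    exact antitone_oneCoeff n hij
  · gcongr
    calc _ ≤ η / 2 + η / 2 := add_le_add hn.le hdη
      _ = η := ENNReal.add_halves η

/-- For `β = 1` and `f ∈ L¹(-1,1)`: the series in the iterates `T₁^n (Q₁ f)` converge
absolutely pointwise; `|T₁^n (Q₁ f)(x)| ≤ (2/π)(1-x²)⁻¹ ‖f‖_{L¹(-1,1)}`; and
`T₁^n (Q₁ f) → 0` uniformly on compact subsets of `(-1,1)`. -/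
theorem subtransfer_one_iterates_of_Q_decay
    (f : ℝ → ℝ) (hf : IntegrableOn f (Ioo (-1) 1)) :
    (∀ n : ℕ, 1 ≤ n → ∀ k : ℕ, k < n → ∀ x ∈ Ioo (-1 : ℝ) 1,
      Summable (fun j : {j : ℤ // j ≠ 0} =>
        |(1 / (x + 2 * ((j : ℤ) : ℝ)) ^ 2) *
          ((Tsub 1)^[k] (Qone f)) (-1 / (x + 2 * ((j : ℤ) : ℝ)))|)) ∧
    (∀ n : ℕ, 1 ≤ n → ∀ x ∈ Ioo (-1 : ℝ) 1,
      |(Tsub 1)^[n] (Qone f) x| ≤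
        (2 / Real.pi) * (1 - x ^ 2)⁻¹ * ∫ t in Ioo (-1 : ℝ) 1, |f t|) ∧
    (∀ K : Set ℝ, IsCompact K → K ⊆ Ioo (-1 : ℝ) 1 →
      TendstoUniformlyOn (fun (n : ℕ) (x : ℝ) => (Tsub 1)^[n] (Qone f) x)
        (fun _ => (0 : ℝ)) atTop K) := by
  have hpos : ∀ x ∈ Ioo (-1 : ℝ) 1, 0 < 1 - x ^ 2 := fun x hx => by
    nlinarith [hx.1, hx.2]
  have hbound : ∀ n, ∀ x ∈ Ioo (-1 : ℝ) 1, ‖(Tsub 1)^[n] (Qone f) x‖ₑ ≤ evenSeries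
      (fun _ => ENNReal.ofReal (2 / Real.pi) * ∫⁻ t in Ioo (-1 : ℝ) 1, ‖f t‖ₑ) x := fun n => by
    have h := enorm_iterate_Tsub_le (fun x hx => enorm_Qone_le_evenSeries_const f hx) n
    rwa [iterate_evenStep_const] at h
  refine ⟨fun n _ k _ x hx => ?_, fun n _ x hx => ?_, fun K hK hKsub => ?_⟩
  · exact summable_abs_Tsub_term
      (ENNReal.mul_ne_top ENNReal.ofReal_ne_top hf.hasFiniteIntegral.ne) (hbound k) hx
  · have h := hbound n x hx
    have hL : ∫⁻ t in Ioo (-1 : ℝ) 1, ‖f t‖ₑ =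
        ENNReal.ofReal (∫ t in Ioo (-1 : ℝ) 1, |f t|) :=
      (ofReal_integral_norm_eq_lintegral_enorm hf).symm
    have hI : 0 ≤ ∫ t in Ioo (-1 : ℝ) 1, |f t| := integral_nonneg fun t => abs_nonneg _
    have hx2 := hpos x hx
    rw [evenSeries_const _ hx, hL, ← ENNReal.ofReal_mul (by positivity),
      ← ENNReal.ofReal_mul (by positivity), Real.enorm_eq_ofReal_abs,
      ENNReal.ofReal_le_ofReal_iff (by positivity)] at h
    rwa [mul_right_comm]
  · have hcont : ContinuousOn (fun x : ℝ => (1 - x ^ 2)⁻¹) K :=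
      ContinuousOn.inv₀ (by fun_prop) fun x hx => (hpos x (hKsub hx)).ne'
    obtain ⟨H, hH⟩ := hK.exists_bound_of_continuousOn hcont
    rw [Metric.tendstoUniformlyOn_iff]
    intro ε hε
    set H' : ℝ := max H 1 with hH'
    have hH'pos : 0 < H' := lt_of_lt_of_le one_pos (le_max_right _ _)
    have hη : ENNReal.ofReal (ε / (2 * H')) ≠ 0 := by
      rw [ne_eq, ENNReal.ofReal_eq_zero, not_le]
      positivity
    filter_upwards [eventually_enorm_iterate_Tsub_Qone_le hf hη] with n hn x hx
    have hx2 := hpos x (hKsub hx)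
    have h := hn x (hKsub hx)
    rw [← ENNReal.ofReal_mul (by positivity), Real.enorm_eq_ofReal_abs,
      ENNReal.ofReal_le_ofReal_iff (by positivity)] at h
    rw [dist_zero_left, Real.norm_eq_abs]
    have hle : (1 - x ^ 2)⁻¹ ≤ H' :=
      ((le_abs_self _).trans (hH x hx)).trans (le_max_left _ _)
    calc _ ≤ ε / (2 * H') * (1 - x ^ 2)⁻¹ := h
      _ ≤ ε / (2 * H') * H' := by gcongr
      _ = ε / 2 := by field_simp
      _ < ε := half_lt_self hε
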